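/- Let S_N be the symmetric 3×3 real matrix with (3,3)-entry 1 and all other entries 0 (the Petrov type N normal form, with Ψ₄ = 1 and all other curvature components zero). Then the stabilizer algebra stab(S_N) = {A ∈ so(G) : Aᵀ·S_N + S_N·A = 0} is exactly the one-dimensional span of the null-rotation generator N with rows (0,1,0),(0,0,2),(0,0,0). -/

import Mathlib

open Matrix

/-- The Gram matrix of the 3-dimensional Lorentzian inner product in a null triad. -/
noncomputable def Gmat : Matrix (Fin 3) (Fin 3) ℝ := !![0, 0, -1; 0, 1/2, 0; -1, 0, 0]

/-- The stabilizer algebra of a symmetric matrix `S` inside `so(G)`: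
matrices `A` with `Aᵀ·G + G·A = 0` and `Aᵀ·S + S·A = 0`. -/
noncomputable def stab (S : Matrix (Fin 3) (Fin 3) ℝ) :
    Submodule ℝ (Matrix (Fin 3) (Fin 3) ℝ) where
  carrier := {A | Aᵀ * Gmat + Gmat * A = 0 ∧ Aᵀ * S + S * A = 0}
  zero_mem' := by constructor <;> simp
  add_mem' := by
    rintro a b ⟨ha1, ha2⟩ ⟨hb1, hb2⟩
    constructor
    · have h : (a + b)ᵀ * Gmat + Gmat * (a + b)
          = (aᵀ * Gmat + Gmat * a) + (bᵀ * Gmat + Gmat * b) := by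
        rw [Matrix.transpose_add]; noncomm_ring
      rw [h, ha1, hb1, add_zero]
    · have h : (a + b)ᵀ * S + S * (a + b)
          = (aᵀ * S + S * a) + (bᵀ * S + S * b) := by
        rw [Matrix.transpose_add]; noncomm_ring
      rw [h, ha2, hb2, add_zero]
  smul_mem' := by
    rintro c a ⟨ha1, ha2⟩
    constructor
    · have h : (c • a)ᵀ * Gmat + Gmat * (c • a) = c • (aᵀ * Gmat + Gmat * a) := by
        rw [Matrix.transpose_smul, Matrix.smul_mul, Matrix.mul_smul, smul_add]
      rw [h, ha1, smul_zero]
    · have h : (c • a)ᵀ * S + S * (c • a) = c • (aᵀ * S + S * a) := by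
        rw [Matrix.transpose_smul, Matrix.smul_mul, Matrix.mul_smul, smul_add]
      rw [h, ha2, smul_zero]

/-- The Petrov type N normal form (`Ψ₄ = 1`, all other components zero). -/
noncomputable def S_N : Matrix (Fin 3) (Fin 3) ℝ := !![0, 0, 0; 0, 0, 0; 0, 0, 1]

/-- The null-rotation generator. -/
noncomputable def Nrot : Matrix (Fin 3) (Fin 3) ℝ := !![0, 1, 0; 0, 0, 2; 0, 0, 0]

/-- The stabilizer algebra of the Petrov type N normal form is exactly the
one-dimensional span of the null-rotation generator (table entry `s₀ = 1` for type N). -/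
theorem stab_typeN : stab S_N = Submodule.span ℝ {Nrot} := by
  ext A
  rw [Submodule.mem_span_singleton]
  constructor
  · rintro ⟨hG, hS⟩
    refine ⟨A 0 1, ?_⟩
    rw [← Matrix.ext_iff] at hG hS
    simp only [Matrix.add_apply, Matrix.mul_apply, Fin.sum_univ_three, Matrix.transpose_apply,
      Matrix.zero_apply] at hG hS
    have h01 := hG 0 1
    have h02 := hG 0 2
    have h11 := hG 1 1
    have h12 := hG 1 2
    have h22 := hG 2 2
    have k02 := hS 0 2
    have k12 := hS 1 2
    have k22 := hS 2 2
    simp [Gmat] at h01 h02 h11 h12 h22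
    simp [S_N] at k02 k12 k22
    ext i j
    fin_cases i <;> fin_cases j <;> simp [Nrot] <;> linarith
  · rintro ⟨c, rfl⟩
    refine (stab S_N).smul_mem c ⟨?_, ?_⟩ <;> ext i j <;> fin_cases i <;> fin_cases j <;>
      simp [Matrix.mul_apply, Fin.sum_univ_succ, Gmat, S_N, Nrot]
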